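/- The family of linear functionals (f_P), indexed by the set partitions P of Fin k having at most n blocks, is a basis of the subspace of linear functionals φ : W_k → 𝕜 that are invariant under the Perm (Fin n)-action (φ(σ • g) = φ(g) for all σ ∈ Perm (Fin n) and g ∈ W_k). (Proposition: the f_D with D : k → 0 having at most n parts form a basis of Hom_{S_n}(V^{⊗k}, 1).) -/

import Mathlib

open scoped Classical

noncomputable section

namespace Jellyfish

variable {𝕜 : Type*} [Field 𝕜]

/-- The indicator (delta) function `δ_i` of a tuple `i`, a basis vector of
`W = (ι → Fin n) → 𝕜`. -/
def delta {ι : Type*} {n : ℕ} (i : ι → Fin n) : (ι → Fin n) → 𝕜 :=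
  fun j => if j = i then 1 else 0

/-- The linear action of `Equiv.Perm (Fin n)` on `(ι → Fin n) → 𝕜`; it satisfies
`permAct σ (delta i) = delta (σ ∘ i)`. -/
def permAct {ι : Type*} {n : ℕ} (σ : Equiv.Perm (Fin n)) (g : (ι → Fin n) → 𝕜) :
    (ι → Fin n) → 𝕜 :=
  fun j => g (⇑σ.symm ∘ j)

/-- `DET i`: the determinant of the `n × n` matrix whose `b`-th column is the standard
basis vector `e_{i b}`; entry `(a,b)` is `1` if `i b = a` and `0` otherwise. -/
def DET {n : ℕ} (i : Fin n → Fin n) : 𝕜 :=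
  Matrix.det (Matrix.of fun a b => if i b = a then (1 : 𝕜) else 0)

/-- `a` and `b` lie in a common block of the set partition `P`. -/
def sameBlock {ι : Type*} [DecidableEq ι] [Fintype ι]
    (P : Finpartition (Finset.univ : Finset ι)) (a b : ι) : Prop :=
  ∃ B ∈ P.parts, a ∈ B ∧ b ∈ B

/-- The tuple `i` is constant on every block of the set partition `P`. -/
def constOnBlocks {ι : Type*} [DecidableEq ι] [Fintype ι] {n : ℕ}
    (P : Finpartition (Finset.univ : Finset ι)) (i : ι → Fin n) : Prop :=
  ∀ a b : ι, sameBlock P a b → i a = i b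

/-- The kernel (partition into fibers) of the map `p` equals the set partition `P`. -/
def kernelEq {ι : Type*} [DecidableEq ι] [Fintype ι] {m : ℕ}
    (p : ι → Fin m) (P : Finpartition (Finset.univ : Finset ι)) : Prop :=
  ∀ a b : ι, p a = p b ↔ sameBlock P a b

/-- The linear functional `Φ_P` with `Φ_P (δ_i) = 1` if `i` is constant on every
block of `P`, and `0` otherwise. -/
def PhiP {k n : ℕ} (P : Finpartition (Finset.univ : Finset (Fin k))) :
    ((Fin k → Fin n) → 𝕜) →ₗ[𝕜] 𝕜 :=
  ∑ i : Fin k → Fin n,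
    (if constOnBlocks P i then (1 : 𝕜) else 0) •
      (LinearMap.proj i : ((Fin k → Fin n) → 𝕜) →ₗ[𝕜] 𝕜)

/-- The linear functional `f_P` with `f_P (δ_i) = 1` if the kernel of `i` equals `P`,
and `0` otherwise. -/
def fP {k n : ℕ} (P : Finpartition (Finset.univ : Finset (Fin k))) :
    ((Fin k → Fin n) → 𝕜) →ₗ[𝕜] 𝕜 :=
  ∑ i : Fin k → Fin n,
    (if kernelEq i P then (1 : 𝕜) else 0) •
      (LinearMap.proj i : ((Fin k → Fin n) → 𝕜) →ₗ[𝕜] 𝕜)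

/-- The jellyfish functional `J_{p,r}`: `J_{p,r} (δ_i) = DET (i ∘ r)` if `i` is constant
on every fiber of `p`, and `0` otherwise. -/
def Jf {k n : ℕ} (p : Fin k → Fin n) (r : Fin n → Fin k) :
    ((Fin k → Fin n) → 𝕜) →ₗ[𝕜] 𝕜 :=
  ∑ i : Fin k → Fin n,
    (if ∀ a b : Fin k, p a = p b → i a = i b then DET (i ∘ r) else (0 : 𝕜)) •
      (LinearMap.proj i : ((Fin k → Fin n) → 𝕜) →ₗ[𝕜] 𝕜)

/-- The `n × n` matrix `M(i)` whose column `c`, for `c : Fin (n-1)` embedded as the first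
`n-1` columns, is the standard basis vector `e_{i (r c)}`, and whose last column is the
all-ones vector. -/
def Mmat {k n : ℕ} (r : Fin (n - 1) → Fin k) (i : Fin k → Fin n) :
    Matrix (Fin n) (Fin n) 𝕜 :=
  Matrix.of fun a b =>
    if h : (b : ℕ) < n - 1 then (if i (r ⟨(b : ℕ), h⟩) = a then 1 else 0) else 1

/-- The jellyfish functional `J'_{p,r}` (one dangling leg): `J'_{p,r} (δ_i) = det M(i)`
if `i` is constant on every fiber of `p`, and `0` otherwise. -/
def Jf' {k n : ℕ} (p : Fin k → Fin (n - 1)) (r : Fin (n - 1) → Fin k) :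
    ((Fin k → Fin n) → 𝕜) →ₗ[𝕜] 𝕜 :=
  ∑ i : Fin k → Fin n,
    (if ∀ a b : Fin k, p a = p b → i a = i b then (Mmat r i).det else (0 : 𝕜)) •
      (LinearMap.proj i : ((Fin k → Fin n) → 𝕜) →ₗ[𝕜] 𝕜)

/-- The linear map `T_P : W_k → W_ℓ` with `(T_P δ_i) (i') = 1` if `Sum.elim i i'` is
constant on every block of `P`, and `0` otherwise. -/
def TP {k l n : ℕ} (P : Finpartition (Finset.univ : Finset (Fin k ⊕ Fin l))) :
    ((Fin k → Fin n) → 𝕜) →ₗ[𝕜] ((Fin l → Fin n) → 𝕜) :=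
  ∑ i : Fin k → Fin n, ∑ i' : Fin l → Fin n,
    (if constOnBlocks P (Sum.elim i i') then (1 : 𝕜) else 0) •
      ((LinearMap.single 𝕜 (fun _ : Fin l → Fin n => 𝕜) i').comp
        (LinearMap.proj i : ((Fin k → Fin n) → 𝕜) →ₗ[𝕜] 𝕜))

/-- The subspace of linear functionals on `(ι → Fin n) → 𝕜` invariant under all
permutations in `S`. -/
def invariantDual (𝕜 : Type*) [Field 𝕜] (ι : Type*) {n : ℕ}
    (S : Set (Equiv.Perm (Fin n))) :
    Submodule 𝕜 (((ι → Fin n) → 𝕜) →ₗ[𝕜] 𝕜) where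
  carrier := {φ | ∀ σ ∈ S, ∀ g : (ι → Fin n) → 𝕜, φ (permAct σ g) = φ g}
  add_mem' := by
    intro φ ψ hφ hψ σ hσ g
    simp only [LinearMap.add_apply, hφ σ hσ g, hψ σ hσ g]
  zero_mem' := by intro σ hσ g; simp
  smul_mem' := by
    intro c φ hφ σ hσ g
    simp only [LinearMap.smul_apply, hφ σ hσ g]

/-- The subspace of linear maps `W_k → W_ℓ` commuting with the actions of all
permutations in `S`. -/
def equivariantMaps (𝕜 : Type*) [Field 𝕜] (k l : ℕ) {n : ℕ}
    (S : Set (Equiv.Perm (Fin n))) :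
    Submodule 𝕜 (((Fin k → Fin n) → 𝕜) →ₗ[𝕜] ((Fin l → Fin n) → 𝕜)) where
  carrier := {T | ∀ σ ∈ S, ∀ g : (Fin k → Fin n) → 𝕜, T (permAct σ g) = permAct σ (T g)}
  add_mem' := by
    intro T T' hT hT' σ hσ g
    funext j
    simp [LinearMap.add_apply, hT σ hσ g, hT' σ hσ g, permAct]
  zero_mem' := by intro σ hσ g; funext j; simp [permAct]
  smul_mem' := by
    intro c T hT σ hσ g
    funext j
    simp [LinearMap.smul_apply, hT σ hσ g, permAct]

end Jellyfish

open Jellyfish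

namespace Jellyfish

variable {𝕜 : Type*} [Field 𝕜]

section Partitions

variable {ι : Type*} [DecidableEq ι] [Fintype ι]

lemma sameBlock_iff_mem_part {P : Finpartition (Finset.univ : Finset ι)} {a b : ι} :
    sameBlock P a b ↔ a ∈ P.part b :=
  P.mem_part_iff_exists.symm

lemma mem_part_iff_of_kernelEq {n : ℕ} {i : ι → Fin n}
    {P : Finpartition (Finset.univ : Finset ι)} (h : kernelEq i P) {a b : ι} :
    a ∈ P.part b ↔ i a = i b :=
  sameBlock_iff_mem_part.symm.trans (h a b).symm

/-- A tuple has only one kernel. -/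
lemma kernelEq.unique {n : ℕ} {i : ι → Fin n}
    {P Q : Finpartition (Finset.univ : Finset ι)} (hP : kernelEq i P) (hQ : kernelEq i Q) :
    P = Q := by
  have hpart : ∀ b, P.part b = Q.part b := fun b => by
    ext a
    rw [mem_part_iff_of_kernelEq hP, mem_part_iff_of_kernelEq hQ]
  ext B
  constructor <;> intro hB
  · obtain ⟨a, ha⟩ := P.nonempty_of_mem_parts hB
    rw [← P.part_eq_of_mem hB ha, hpart, Q.part_mem]
    exact Finset.mem_univ a
  · obtain ⟨a, ha⟩ := Q.nonempty_of_mem_parts hB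
    rw [← Q.part_eq_of_mem hB ha, ← hpart, P.part_mem]
    exact Finset.mem_univ a

lemma exists_kernelEq {n : ℕ} (i : ι → Fin n) :
    ∃ P : Finpartition (Finset.univ : Finset ι), kernelEq i P := by
  refine ⟨Finpartition.ofSetoid (Setoid.ker i), fun a b => ?_⟩
  rw [sameBlock_iff_mem_part, Finpartition.mem_part_ofSetoid_iff_rel, Setoid.ker_def]
  exact eq_comm

lemma kernelEq.card_parts_le {n : ℕ} {i : ι → Fin n}
    {P : Finpartition (Finset.univ : Finset ι)} (h : kernelEq i P) : P.parts.card ≤ n := by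
  have hsurj : Set.SurjOn (fun m => Finset.univ.filter fun a => i a = m)
      (Finset.univ : Finset (Fin n)) P.parts := by
    intro B hB
    obtain ⟨b, hb⟩ := P.nonempty_of_mem_parts hB
    refine ⟨i b, by simp, ?_⟩
    rw [← P.part_eq_of_mem hB hb]
    ext a
    simp [mem_part_iff_of_kernelEq h]
  simpa using Finset.card_le_card_of_surjOn _ hsurj

lemma exists_tuple_kernelEq {n : ℕ} {P : Finpartition (Finset.univ : Finset ι)}
    (hP : P.parts.card ≤ n) : ∃ i : ι → Fin n, kernelEq i P := by
  obtain ⟨e⟩ : Nonempty (P.parts ↪ Fin n) :=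
    Function.Embedding.nonempty_of_card_le (by simpa using hP)
  refine ⟨fun a => e ⟨P.part a, P.part_mem.2 (Finset.mem_univ a)⟩, fun a b => ?_⟩
  rw [sameBlock_iff_mem_part, e.injective.eq_iff, Subtype.mk.injEq,
    P.mem_part_iff_part_eq_part (Finset.mem_univ a) (Finset.mem_univ b)]

lemma kernelEq_perm_comp {n : ℕ} (σ : Equiv.Perm (Fin n)) (i : ι → Fin n)
    (P : Finpartition (Finset.univ : Finset ι)) : kernelEq (σ ∘ i) P ↔ kernelEq i P := by
  simp [kernelEq]

end Partitions

/-- Two tuples with the same kernel are in the same orbit. -/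
lemma exists_perm_comp_eq {ι : Type*} {n : ℕ} {i j : ι → Fin n}
    (h : ∀ a b, i a = i b ↔ j a = j b) : ∃ σ : Equiv.Perm (Fin n), ⇑σ ∘ i = j := by
  let e : Set.range i ≃ Set.range j :=
    (Setoid.quotientKerEquivRange i).symm.trans
      ((Quotient.congrRight h).trans (Setoid.quotientKerEquivRange j))
  have he : ∀ a, (e ⟨i a, a, rfl⟩ : Fin n) = j a := fun a => by
    have hsymm : (Setoid.quotientKerEquivRange i).symm ⟨i a, a, rfl⟩ = Quotient.mk'' a := by
      rw [Equiv.symm_apply_eq]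
      rfl
    simp only [e, Equiv.trans_apply, hsymm]
    rfl
  refine ⟨e.extendSubtype, funext fun a => ?_⟩
  exact (e.extendSubtype_apply_of_mem (i a) ⟨a, rfl⟩).trans (he a)

lemma permAct_delta {ι : Type*} {n : ℕ} (σ : Equiv.Perm (Fin n)) (i : ι → Fin n) :
    permAct σ (delta i : (ι → Fin n) → 𝕜) = delta (σ ∘ i) := by
  funext j
  simp only [permAct, delta, Equiv.symm_comp_eq]

lemma dual_ext_delta {ι : Type*} [Finite ι] {n : ℕ} {φ ψ : ((ι → Fin n) → 𝕜) →ₗ[𝕜] 𝕜}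
    (h : ∀ i, φ (delta i) = ψ (delta i)) : φ = ψ := by
  have hdelta : ∀ i : ι → Fin n, (Pi.single i 1 : (ι → Fin n) → 𝕜) = delta i := fun i => by
    funext j
    simp [delta, Pi.single_apply]
  refine LinearMap.pi_ext' fun i => LinearMap.ext_ring ?_
  simpa [hdelta] using h i

section

variable {k n : ℕ}

lemma fP_delta (P : Finpartition (Finset.univ : Finset (Fin k))) (i : Fin k → Fin n) :
    fP P (delta i : (Fin k → Fin n) → 𝕜) = if kernelEq i P then 1 else 0 := by
  simp only [fP, LinearMap.sum_apply, LinearMap.smul_apply, LinearMap.proj_apply]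
  simp [delta]

lemma fP_mem_invariantDual (P : Finpartition (Finset.univ : Finset (Fin k)))
    (S : Set (Equiv.Perm (Fin n))) :
    (fP P : ((Fin k → Fin n) → 𝕜) →ₗ[𝕜] 𝕜) ∈ invariantDual 𝕜 (Fin k) S := by
  intro σ _ g
  simp only [fP, LinearMap.sum_apply, LinearMap.smul_apply, LinearMap.proj_apply, permAct]
  refine Fintype.sum_equiv (Equiv.arrowCongr (Equiv.refl _) σ.symm) _ _ fun i => ?_
  change _ = (if kernelEq (⇑σ.symm ∘ i) P then (1 : 𝕜) else 0) • g (⇑σ.symm ∘ i)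
  simp only [kernelEq_perm_comp]

/-- The functionals `f_P` are dual to any choice of tuples with prescribed kernels. -/
lemma fP_delta_of_kernelEq {P Q : Finpartition (Finset.univ : Finset (Fin k))}
    {i : Fin k → Fin n} (hi : kernelEq i Q) :
    fP P (delta i : (Fin k → Fin n) → 𝕜) = if P = Q then 1 else 0 := by
  rw [fP_delta]
  congr 1
  exact propext ⟨fun h => h.unique hi, fun h => h ▸ hi⟩

lemma linearIndependent_fP :
    LinearIndependent 𝕜
      (fun P : {P : Finpartition (Finset.univ : Finset (Fin k)) // P.parts.card ≤ n} =>
        (fP P.1 : ((Fin k → Fin n) → 𝕜) →ₗ[𝕜] 𝕜)) := by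
  rw [linearIndependent_iff']
  intro s c hc Q hQ
  obtain ⟨i, hi⟩ := exists_tuple_kernelEq Q.2
  have h := LinearMap.congr_fun hc (delta i)
  simpa [fP_delta_of_kernelEq hi, ← Subtype.ext_iff, hQ] using h

lemma span_range_fP :
    Submodule.span 𝕜
        (Set.range fun P : {P : Finpartition (Finset.univ : Finset (Fin k)) //
            P.parts.card ≤ n} =>
          (fP P.1 : ((Fin k → Fin n) → 𝕜) →ₗ[𝕜] 𝕜)) =
      invariantDual 𝕜 (Fin k) (Set.univ : Set (Equiv.Perm (Fin n))) := by
  apply le_antisymm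
  · rw [Submodule.span_le]
    rintro _ ⟨P, rfl⟩
    exact fP_mem_invariantDual P.1 _
  · intro φ hφ
    choose t ht using fun P : {P : Finpartition (Finset.univ : Finset (Fin k)) //
      P.parts.card ≤ n} => exists_tuple_kernelEq P.2
    have hsum : φ = ∑ P, φ (delta (t P)) • fP P.1 := by
      refine dual_ext_delta fun i => ?_
      obtain ⟨Q, hQ⟩ := exists_kernelEq i
      let Q' : {P : Finpartition (Finset.univ : Finset (Fin k)) // P.parts.card ≤ n} :=
        ⟨Q, hQ.card_parts_le⟩
      obtain ⟨σ, hσ⟩ := exists_perm_comp_eq fun a b => (hQ a b).trans (ht Q' a b).symm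
      have hinv : φ (delta (t Q')) = φ (delta i) := by
        rw [← hσ, ← permAct_delta, hφ σ (Set.mem_univ σ)]
      have hQ' : ∀ P : {P : Finpartition (Finset.univ : Finset (Fin k)) // P.parts.card ≤ n},
          P.1 = Q ↔ P = Q' := fun P => (Subtype.ext_iff (a2 := Q')).symm
      simp [fP_delta_of_kernelEq hQ, hQ', hinv]
    rw [hsum]
    exact Submodule.sum_mem _ fun P _ =>
      Submodule.smul_mem _ _ (Submodule.subset_span ⟨P, rfl⟩)

end

end Jellyfish

/-- the family `(f_P)`, indexed by set partitions of `Fin k` with at most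
`n` blocks, is a basis of the subspace of `Perm (Fin n)`-invariant linear functionals
on `W_k`. -/
theorem statement5 (𝕜 : Type*) [Field 𝕜] (hchar : ringChar 𝕜 ≠ 2)
    (n k : ℕ) (hn : 0 < n) :
    LinearIndependent 𝕜
      (fun P : {P : Finpartition (Finset.univ : Finset (Fin k)) // P.parts.card ≤ n} =>
        (fP P.1 : ((Fin k → Fin n) → 𝕜) →ₗ[𝕜] 𝕜)) ∧
    Submodule.span 𝕜
        (Set.range fun P : {P : Finpartition (Finset.univ : Finset (Fin k)) //
            P.parts.card ≤ n} =>
          (fP P.1 : ((Fin k → Fin n) → 𝕜) →ₗ[𝕜] 𝕜)) =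
      invariantDual 𝕜 (Fin k) (Set.univ : Set (Equiv.Perm (Fin n))) := by
  exact ⟨linearIndependent_fP, span_range_fP⟩
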